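/- Let m ≥ 2 be an integer and c_1, …, c_m positive integers; set n = m − 1 + ∑_{l=1}^m c_l (so that ∑_{l=1}^m c_l = n − m + 1) and N = n − m + 1. Let α_1, …, α_N be pairwise distinct nonzero complex numbers and fix i ∈ {1, …, N}. Then ∑_{j≠i} [ α_i^{m} · ∏_{l=1}^{m} ( c_l · ∏_{a=1}^{c_l−1} ((c_l − a)α_j + a·α_i) ) / ((α_j − α_i)·∏_{k≠i,j}(α_j − α_k)) ] · ( ∑_{k≠i,j} 1/(α_i − α_k) − ∑_{l=1}^{m} 1/(c_l·α_i) ) = ( ∑_{l=1}^{m} 1/c_l − (n − 2m + 1)/2 ) · (∏_{l=1}^{m} c_l^{c_l}) · α_i^{n−m} / ∏_{j≠i}(α_i − α_j). -/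

import Mathlib

open Finset

open Polynomial in
/-- Logarithmic derivative of a finite product of polynomials, evaluated at a point. -/
lemma aux_logder {ι : Type*} (s : Finset ι) (f : ι → ℂ[X]) (x : ℂ)
    (h : ∀ a ∈ s, (f a).eval x ≠ 0) :
    (derivative (∏ a ∈ s, f a)).eval x =
      (∏ a ∈ s, (f a).eval x) * ∑ a ∈ s, (derivative (f a)).eval x / (f a).eval x := by
  classical
  induction s using Finset.induction_on with
  | empty => simp
  | insert a s ha ih =>
    have h1 := h a (mem_insert_self _ _)
    rw [prod_insert ha, prod_insert ha, sum_insert ha, derivative_mul, eval_add, eval_mul,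
      eval_mul, ih (fun b hb => h b (mem_insert_of_mem hb)), eval_prod]
    field_simp

open Polynomial in
/-- Value and derivative of a Lagrange basis polynomial away from the nodes. -/
lemma aux_basis {ι : Type*} [DecidableEq ι] (T : Finset ι) (α : ι → ℂ) (x : ℂ)
    (hx : ∀ k ∈ T, x - α k ≠ 0) (j : ι) (hj : j ∈ T) :
    (Lagrange.basis T α j).eval x =
        (∏ k ∈ T, (x - α k)) / ((x - α j) * ∏ k ∈ T.erase j, (α j - α k)) ∧
    (derivative (Lagrange.basis T α j)).eval x =
        (∏ k ∈ T, (x - α k)) / ((x - α j) * ∏ k ∈ T.erase j, (α j - α k)) *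
          ∑ k ∈ T.erase j, 1 / (x - α k) := by
  have hb : Lagrange.basis T α j =
      C (∏ k ∈ T.erase j, (α j - α k))⁻¹ * ∏ k ∈ T.erase j, (X - C (α k)) := by
    unfold Lagrange.basis Lagrange.basisDivisor
    rw [prod_mul_distrib, ← prod_inv_distrib, map_prod]
  have hxj := hx j hj
  have hp : ∏ k ∈ T, (x - α k) = (x - α j) * ∏ k ∈ T.erase j, (x - α k) :=
    (mul_prod_erase T (fun k => x - α k) hj).symm
  have he : (∏ k ∈ T, (x - α k)) / ((x - α j) * ∏ k ∈ T.erase j, (α j - α k)) =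
      (∏ k ∈ T.erase j, (α j - α k))⁻¹ * ∏ k ∈ T.erase j, (x - α k) := by
    rw [hp, mul_div_mul_left _ _ hxj, div_eq_inv_mul]
  rw [he, hb]
  constructor
  · simp [eval_prod]
  · rw [derivative_C_mul, eval_C_mul, aux_logder]
    · simp [mul_assoc]
    · intro a ha
      simpa using hx a (mem_of_mem_erase ha)

lemma aux_gauss (d : ℕ) (hd : 0 < d) :
    ∑ a ∈ Icc 1 (d - 1), ((d : ℂ) - (a : ℂ)) = (d : ℂ) * ((d : ℂ) - 1) / 2 := by
  obtain ⟨e, rfl⟩ : ∃ e, d = e + 1 := ⟨d - 1, by omega⟩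
  have h : ∀ e : ℕ, ∑ a ∈ Icc 1 e, (a : ℂ) = (e : ℂ) * (e + 1) / 2 := by
    intro e
    induction e with
    | zero => simp
    | succ k ih => rw [sum_Icc_succ_top (by omega), ih]; push_cast; ring
  rw [sum_sub_distrib, Nat.add_sub_cancel, h]
  simp
  ring

/-- Let `m ≥ 2`, `c_1, …, c_m` positive integers, `n = m − 1 + ∑ c_l`,
`N = n − m + 1`. For pairwise distinct nonzero complex numbers `α_1, …, α_N` and fixed `i`,
`∑_{j≠i} [α_i^m · ∏_l (c_l · ∏_{a=1}^{c_l−1} ((c_l − a)α_j + a·α_i))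
            / ((α_j − α_i)·∏_{k≠i,j}(α_j − α_k))]
    · (∑_{k≠i,j} 1/(α_i − α_k) − ∑_l 1/(c_l·α_i))
  = (∑_l 1/c_l − (n − 2m + 1)/2) · (∏_l c_l^{c_l}) · α_i^{n−m} / ∏_{j≠i}(α_i − α_j)`. -/
theorem stmt_5 (m : ℕ) (hm : 2 ≤ m) (c : Fin m → ℕ) (hc : ∀ l, 0 < c l)
    (n N : ℕ) (hn : n = m - 1 + ∑ l, c l) (hN : N = n - m + 1)
    (α : Fin N → ℂ) (hα : Function.Injective α) (hα0 : ∀ j, α j ≠ 0) (i : Fin N) :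
    ∑ j ∈ univ.erase i,
        (α i ^ m *
            (∏ l, ((c l : ℂ) *
              ∏ a ∈ Icc 1 (c l - 1), (((c l : ℂ) - (a : ℂ)) * α j + (a : ℂ) * α i))) /
            ((α j - α i) * ∏ k ∈ (univ.erase i).erase j, (α j - α k))) *
          ((∑ k ∈ (univ.erase i).erase j, 1 / (α i - α k)) -
            ∑ l, 1 / ((c l : ℂ) * α i)) =
      ((∑ l, 1 / (c l : ℂ)) - ((n : ℂ) - 2 * m + 1) / 2) *
          (∏ l, (c l : ℂ) ^ (c l)) * α i ^ (n - m) /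
        (∏ j ∈ univ.erase i, (α i - α j)) := by
  classical
  have hcm : m ≤ ∑ l, c l := by
    calc m = ∑ _l : Fin m, 1 := by simp
      _ ≤ _ := sum_le_sum fun l _ => hc l
  have hNs : N = ∑ l, c l := by omega
  have hx := hα0 i
  have hc0 : ∀ l, (c l : ℂ) ≠ 0 := fun l => by exact_mod_cast (hc l).ne'
  set x := α i with hxdef
  set T := univ.erase i with hT
  have hTc : #T = N - 1 := by rw [hT, card_erase_of_mem (mem_univ i)]; simp
  have hxT : ∀ k ∈ T, x - α k ≠ 0 := by
    intro k hk
    rw [sub_ne_zero]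
    exact fun h => (ne_of_mem_erase hk) (hα h).symm
  set g : Fin m → ℕ → Polynomial ℂ := fun l a =>
    Polynomial.C ((c l : ℂ) - (a : ℂ)) * Polynomial.X + Polynomial.C ((a : ℂ) * x) with hg
  set f : Fin m → Polynomial ℂ := fun l =>
    Polynomial.C (c l : ℂ) * ∏ a ∈ Icc 1 (c l - 1), g l a with hf
  set P : Polynomial ℂ := ∏ l, f l with hP
  have hPe : ∀ z, P.eval z = ∏ l, ((c l : ℂ) *
              ∏ a ∈ Icc 1 (c l - 1), (((c l : ℂ) - (a : ℂ)) * z + (a : ℂ) * x)) := by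
    intro z
    simp [hP, hf, hg, Polynomial.eval_prod]
  have hgx : ∀ l a, (g l a).eval x = c l * x := by
    intro l a
    simp [hg]
    ring
  have hgx0 : ∀ l a, (g l a).eval x ≠ 0 := fun l a => by
    rw [hgx]; exact mul_ne_zero (hc0 l) hx
  have hfx : ∀ l, (f l).eval x = (c l : ℂ) ^ (c l) * x ^ (c l - 1) := by
    intro l
    simp only [hf, Polynomial.eval_mul, Polynomial.eval_C, Polynomial.eval_prod, hgx, prod_const,
      Nat.card_Icc, Nat.add_sub_cancel]
    rw [mul_pow, ← mul_assoc, ← pow_succ', Nat.sub_add_cancel (hc l)]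
  have hfx0 : ∀ l, (f l).eval x ≠ 0 := fun l => by
    rw [hfx]; exact mul_ne_zero (pow_ne_zero _ (hc0 l)) (pow_ne_zero _ hx)
  have hsum1 : ∑ l, (c l - 1) + m = N := by
    rw [hNs]
    calc ∑ l, (c l - 1) + m = ∑ l, (c l - 1) + ∑ _l : Fin m, 1 := by simp
      _ = ∑ l, (c l - 1 + 1) := sum_add_distrib.symm
      _ = _ := sum_congr rfl fun l _ => Nat.sub_add_cancel (hc l)
  have hPx : P.eval x = (∏ l, (c l : ℂ) ^ (c l)) * x ^ (N - m) := by
    rw [hP, Polynomial.eval_prod, prod_congr rfl fun l _ => hfx l, prod_mul_distrib,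
      prod_pow_eq_pow_sum]
    congr 2
    omega
  have hfd : ∀ l, (Polynomial.derivative (f l)).eval x / (f l).eval x
      = ((c l : ℂ) - 1) / (2 * x) := by
    intro l
    have h1 : (Polynomial.derivative (f l)).eval x = (f l).eval x *
        ∑ a ∈ Icc 1 (c l - 1), (Polynomial.derivative (g l a)).eval x / (g l a).eval x := by
      rw [hf]
      simp only
      rw [Polynomial.derivative_C_mul, Polynomial.eval_C_mul, aux_logder _ _ _ fun a _ => hgx0 l a,
        Polynomial.eval_C_mul, Polynomial.eval_prod, mul_assoc]
    rw [h1, mul_div_cancel_left₀ _ (hfx0 l)]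
    have h2 : ∀ a, (Polynomial.derivative (g l a)).eval x = (c l : ℂ) - a := by
      intro a
      simp [hg]
    simp only [h2, hgx]
    rw [← sum_div, aux_gauss _ (hc l)]
    have := hc0 l
    field_simp
  have hPd : (Polynomial.derivative P).eval x = P.eval x * (((N : ℂ) - m) / (2 * x)) := by
    rw [hP, aux_logder _ _ _ fun l _ => hfx0 l, Polynomial.eval_prod]
    simp only [hfd]
    rw [← sum_div, sum_sub_distrib, hNs]
    simp
  have hgdeg : ∀ l a, (g l a).natDegree ≤ 1 := fun l a => Polynomial.natDegree_linear_le
  have hfdeg : ∀ l, (f l).natDegree ≤ c l - 1 := by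
    intro l
    refine (Polynomial.natDegree_C_mul_le _ _).trans ((Polynomial.natDegree_prod_le _ _).trans ?_)
    refine (sum_le_sum fun a _ => hgdeg l a).trans ?_
    simp
  have hPdeg : P.natDegree ≤ N - m := by
    refine (Polynomial.natDegree_prod_le _ _).trans ((sum_le_sum fun l _ => hfdeg l).trans ?_)
    omega
  have hdeg : P.degree < #T := by
    refine Polynomial.degree_le_natDegree.trans_lt ?_
    rw [hTc]
    exact_mod_cast (by omega : P.natDegree < N - 1)
  have hint : P = ∑ j ∈ T, Polynomial.C (P.eval (α j)) * Lagrange.basis T α j := by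
    have := Lagrange.eq_interpolate (s := T) (v := α) hα.injOn hdeg
    rwa [Lagrange.interpolate_apply] at this
  set Q := ∏ k ∈ T, (x - α k) with hQ
  have hQ0 : Q ≠ 0 := prod_ne_zero_iff.mpr hxT
  have e1 : P.eval x = ∑ j ∈ T, P.eval (α j) *
      (Q / ((x - α j) * ∏ k ∈ T.erase j, (α j - α k))) := by
    conv_lhs => rw [hint]
    rw [Polynomial.eval_finset_sum]
    refine sum_congr rfl fun j hj => ?_
    rw [Polynomial.eval_C_mul, (aux_basis T α x hxT j hj).1]
  have e2 : (Polynomial.derivative P).eval x = ∑ j ∈ T, P.eval (α j) *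
      (Q / ((x - α j) * ∏ k ∈ T.erase j, (α j - α k)) * ∑ k ∈ T.erase j, 1 / (x - α k)) := by
    conv_lhs => rw [hint]
    rw [Polynomial.derivative_sum, Polynomial.eval_finset_sum]
    refine sum_congr rfl fun j hj => ?_
    rw [Polynomial.derivative_C_mul, Polynomial.eval_C_mul, (aux_basis T α x hxT j hj).2]
  have hC : ∑ l, 1 / ((c l : ℂ) * x) = (∑ l, 1 / (c l : ℂ)) / x := by
    rw [sum_div]
    exact sum_congr rfl fun l _ => by rw [div_div]
  have key : ∑ j ∈ T, (x ^ m * P.eval (α j) /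
        ((α j - x) * ∏ k ∈ T.erase j, (α j - α k))) *
        ((∑ k ∈ T.erase j, 1 / (x - α k)) - (∑ l, 1 / (c l : ℂ)) / x) =
      x ^ m / Q * ((∑ l, 1 / (c l : ℂ)) / x * P.eval x - (Polynomial.derivative P).eval x) := by
    rw [e1, e2, mul_sum, ← sum_sub_distrib, mul_sum]
    refine sum_congr rfl fun j hj => ?_
    have h1 : (α j - x) = -(x - α j) := by ring
    rw [h1]
    have h2 := hxT j hj
    have h3 : ∏ k ∈ T.erase j, (α j - α k) ≠ 0 := prod_ne_zero_iff.mpr fun k hk =>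
      sub_ne_zero.mpr fun h => ne_of_mem_erase hk (hα h).symm
    generalize (∏ k ∈ T.erase j, (α j - α k)) = D at *
    generalize (∑ k ∈ T.erase j, 1 / (x - α k)) = S at *
    generalize (∑ l, 1 / (c l : ℂ)) = K at *
    field_simp
    ring
  simp only [← hPe, hC]
  rw [key, hPd, hPx]
  have hnm : x ^ (n - m) * x = x ^ m * x ^ (N - m) := by
    rw [← pow_succ, ← pow_add]
    congr 1
    omega
  have hNn : (N : ℂ) - m = (n : ℂ) - 2 * m + 1 := by
    have : N + m = n + 1 := by omega
    have h : (N : ℂ) + m = n + 1 := by exact_mod_cast this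
    linear_combination h
  rw [hNn]
  generalize (∑ l, 1 / (c l : ℂ)) = K at *
  generalize (∏ l, (c l : ℂ) ^ (c l)) = R at *
  have h5 : x ^ (n - m) = x ^ m * x ^ (N - m) / x := by
    rw [← hnm]; field_simp
  rw [h5]
  field_simp
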